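/- Let K_{m₁,m₂} have bipartition X = {x₁,…,x_{m₁}}, Y = {y₁,…,y_{m₂}}, 2 ≤ m₁ ≤ m₂, and S_i = {x₁,…,x_i, y₁,…,y_{s−i}} with max{1, s−m₂} ≤ i ≤ min{m₁, s−1} and s ≥ m₂ − m₁ + 3. If 2 ≤ 2i ≤ m₁ + s − m₂, then κ*_{K_{m₁,m₂}}(S_i) ≥ m₁ − i when 2i ≤ 2(m₁+s−m₂)/3, and κ*_{K_{m₁,m₂}}(S_i) ≥ m₂ − (s−i) + ⌊(m₁+s−m₂−i)/2⌋ when 2(m₁+s−m₂)/3 < 2i ≤ m₁ + s − m₂. -/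

import Mathlib

open SimpleGraph

/-- A walk of `G` lies inside the subgraph `T` if all of its edges are edges of `T`. -/
def SimpleGraph.Subgraph.walkIn {V : Type*} {G : SimpleGraph V} (T : G.Subgraph)
    {u v : V} (P : G.Walk u v) : Prop :=
  ∀ e ∈ P.edges, e ∈ T.edgeSet

/-- `T` is an `S`-Steiner tree of `G`: a subtree of `G` containing all of `S`
all of whose leaves (vertices without two distinct neighbours) lie in `S`. -/
def SimpleGraph.IsSteinerTree {V : Type*} (G : SimpleGraph V) (S : Set V)
    (T : G.Subgraph) : Prop :=
  T.coe.IsTree ∧ S ⊆ T.verts ∧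
    ∀ v ∈ T.verts, ¬ (∃ a b, a ≠ b ∧ T.Adj v a ∧ T.Adj v b) → v ∈ S

/-- A family of subgraphs of `G` is completely independent (w.r.t. the terminal set `S`)
if the members are pairwise edge-disjoint, their vertex sets pairwise intersect exactly
in `S`, and for any two vertices of `S`, paths connecting them inside two distinct members
are internally disjoint. -/
def SimpleGraph.CompletelyIndependent {V : Type*} (G : SimpleGraph V) (S : Set V)
    {ι : Type*} (Ts : ι → G.Subgraph) : Prop :=
  ∀ p q, p ≠ q →
    (Ts p).edgeSet ∩ (Ts q).edgeSet = ∅ ∧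
    (Ts p).verts ∩ (Ts q).verts = S ∧
    ∀ x₁ ∈ S, ∀ x₂ ∈ S, x₁ ≠ x₂ →
      ∀ P Q : G.Walk x₁ x₂, P.IsPath → Q.IsPath →
        (Ts p).walkIn P → (Ts q).walkIn Q →
        ∀ v ∈ P.support, v ∈ Q.support → v = x₁ ∨ v = x₂

/-- A family of subgraphs of `G` is internally disjoint (w.r.t. the terminal set `S`)
if the members are pairwise edge-disjoint and their vertex sets pairwise intersect
exactly in `S`. -/
def SimpleGraph.InternallyDisjoint {V : Type*} (G : SimpleGraph V) (S : Set V)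
    {ι : Type*} (Ts : ι → G.Subgraph) : Prop :=
  ∀ p q, p ≠ q →
    (Ts p).edgeSet ∩ (Ts q).edgeSet = ∅ ∧ (Ts p).verts ∩ (Ts q).verts = S

/-- `κ*_G(S)`: the maximum number of pairwise completely independent `S`-Steiner trees. -/
noncomputable def SimpleGraph.cisstPacking {V : Type*} (G : SimpleGraph V) (S : Set V) : ℕ :=
  sSup {k | ∃ Ts : Fin k → G.Subgraph,
    (∀ i, G.IsSteinerTree S (Ts i)) ∧ G.CompletelyIndependent S Ts}

/-- `κ_G(S)`: the maximum number of pairwise internally disjoint `S`-Steiner trees. -/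
noncomputable def SimpleGraph.idstPacking {V : Type*} (G : SimpleGraph V) (S : Set V) : ℕ :=
  sSup {k | ∃ Ts : Fin k → G.Subgraph,
    (∀ i, G.IsSteinerTree S (Ts i)) ∧ G.InternallyDisjoint S Ts}

/-- The generalized `k*`-connectivity `κ*_k(G)`. -/
noncomputable def SimpleGraph.genConnStar {V : Type*} (G : SimpleGraph V) (k : ℕ) : ℕ :=
  sInf (G.cisstPacking '' {S : Set V | S.ncard = k})

/-- The generalized `k`-connectivity `κ_k(G)`. -/
noncomputable def SimpleGraph.genConnK {V : Type*} (G : SimpleGraph V) (k : ℕ) : ℕ :=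
  sInf (G.idstPacking '' {S : Set V | S.ncard = k})

namespace SimpleGraph

variable {V : Type*} {G : SimpleGraph V}

/-- The subgraph on `T` joining every vertex of `T` other than the root `r` to its parent. -/
def parentSubgraph (G : SimpleGraph V) (T : Set V) (r : V) (par : V → V) : G.Subgraph where
  verts := T
  Adj u v := u ∈ T ∧ v ∈ T ∧ G.Adj u v ∧ (u ≠ r ∧ v = par u ∨ v ≠ r ∧ u = par v)
  adj_sub h := h.2.2.1
  edge_vert h := h.1
  symm := ⟨fun _ _ h => ⟨h.2.1, h.1, h.2.2.1.symm, h.2.2.2.symm⟩⟩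

/-- A parent map that moves every non-root vertex along an edge to smaller depth
defines a tree. -/
theorem parentSubgraph_isTree [Finite V] {T : Set V} {r : V} {par : V → V} (d : V → ℕ)
    (hr : r ∈ T)
    (hpar : ∀ v ∈ T, v ≠ r → par v ∈ T ∧ G.Adj v (par v) ∧ d (par v) < d v) :
    (parentSubgraph G T r par).coe.IsTree := by
  classical
  have := Fintype.ofFinite V
  have key : ∀ n, ∀ v (hv : v ∈ T), d v ≤ n →
      (parentSubgraph G T r par).coe.Reachable ⟨v, hv⟩ ⟨r, hr⟩ := by
    intro n
    induction n with
    | zero =>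
      intro v hv hd
      by_cases h : v = r
      · subst h; exact Reachable.refl _
      · have := (hpar v hv h).2.2
        omega
    | succ n ih =>
      intro v hv hd
      by_cases h : v = r
      · subst h; exact Reachable.refl _
      · obtain ⟨h1, h2, h3⟩ := hpar v hv h
        refine Reachable.trans (Adj.reachable ?_) (ih (par v) h1 (by omega))
        exact ⟨hv, h1, h2, Or.inl ⟨h, rfl⟩⟩
  have hconn : (parentSubgraph G T r par).coe.Connected := by
    have : Nonempty (parentSubgraph G T r par).verts := ⟨⟨r, hr⟩⟩
    exact ⟨fun u v => (key _ u.1 u.2 le_rfl).trans (key _ v.1 v.2 le_rfl).symm⟩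
  rw [isTree_iff_connected_and_card]
  refine ⟨hconn, le_antisymm ?_ hconn.card_vert_le_card_edgeSet_add_one⟩
  have hle : (parentSubgraph G T r par).coe.edgeSet.ncard ≤
      ({⟨r, hr⟩}ᶜ : Set (parentSubgraph G T r par).verts).ncard := by
    let φ : (parentSubgraph G T r par).verts → Sym2 (parentSubgraph G T r par).verts :=
      fun v => if h : par v.1 ∈ T then s(v, ⟨par v.1, h⟩) else s(v, v)
    refine (Set.ncard_le_ncard ?_ (Set.toFinite _)).trans
      (Set.ncard_image_le (f := φ) (Set.toFinite _))
    intro e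
    induction e with
    | h u v =>
      intro h
      obtain ⟨hu, hv, -, ⟨h1, h2⟩ | ⟨h1, h2⟩⟩ :
        u.1 ∈ T ∧ v.1 ∈ T ∧ G.Adj u v ∧ (u.1 ≠ r ∧ v.1 = par u ∨ v.1 ≠ r ∧ u.1 = par v) := h
      · refine ⟨u, fun h => h1 (congrArg Subtype.val h), ?_⟩
        have : par u.1 ∈ T := h2 ▸ hv
        simp only [φ, this, dif_pos]
        rw [show (⟨par u.1, this⟩ : (parentSubgraph G T r par).verts) = v from
          Subtype.ext h2.symm]
      · refine ⟨v, fun h => h1 (congrArg Subtype.val h), ?_⟩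
        have : par v.1 ∈ T := h2 ▸ hu
        simp only [φ, this, dif_pos]
        rw [show (⟨par v.1, this⟩ : (parentSubgraph G T r par).verts) = u from
          Subtype.ext h2.symm, Sym2.eq_swap]
  have hc := Set.ncard_add_ncard_compl ({⟨r, hr⟩} : Set (parentSubgraph G T r par).verts)
  rw [Set.ncard_singleton] at hc
  rw [Nat.card_coe_set_eq]
  omega

/-- An interior vertex of a path has two distinct neighbours along the path. -/
theorem Walk.IsPath.exists_two_edges {u w : V} {P : G.Walk u w} (hP : P.IsPath) {v : V}
    (hv : v ∈ P.support) (hu : v ≠ u) (hw : v ≠ w) :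
    ∃ a b, a ≠ b ∧ s(v, a) ∈ P.edges ∧ s(v, b) ∈ P.edges := by
  induction P with
  | nil => simp_all
  | @cons u u' w h p ih =>
    rw [Walk.cons_isPath_iff] at hP
    have hv' : v ∈ p.support := by
      rw [Walk.support_cons, List.mem_cons] at hv
      exact hv.resolve_left hu
    by_cases hvu : v = u'
    · subst hvu
      cases p with
      | nil => exact absurd rfl hw
      | @cons _ z _ h' p' =>
        refine ⟨u, z, ?_, ?_, ?_⟩
        · rintro rfl
          exact hP.2 (by simp)
        · simp [Sym2.eq_swap]
        · simp
    · obtain ⟨a, b, hab, ha, hb⟩ := ih hP.1 hv' hvu hw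
      exact ⟨a, b, hab, by simp [ha], by simp [hb]⟩

/-- A family of completely independent Steiner trees bounds `cisstPacking` from below. -/
theorem le_cisstPacking [Finite V] {S : Set V} (hS : S.Nontrivial) {k : ℕ}
    (Ts : Fin k → G.Subgraph) (hT : ∀ i, G.IsSteinerTree S (Ts i))
    (hI : G.CompletelyIndependent S Ts) : k ≤ G.cisstPacking S := by
  refine le_csSup ⟨Nat.card G.edgeSet, ?_⟩ ⟨Ts, hT, hI⟩
  rintro n ⟨Us, hU, hUI⟩
  have hedge : ∀ i, ∃ e, e ∈ (Us i).edgeSet := by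
    intro i
    obtain ⟨u, hu, v, hv, huv⟩ := hS
    obtain ⟨ht, hsub, -⟩ := hU i
    obtain ⟨p⟩ := ht.connected.preconnected ⟨u, hsub hu⟩ ⟨v, hsub hv⟩
    cases p with
    | nil => exact absurd rfl huv
    | @cons _ z _ h _ => exact ⟨s(u, z.1), h⟩
  choose e he using hedge
  have hinj : Function.Injective
      (fun i => (⟨e i, (Us i).edgeSet_subset (he i)⟩ : G.edgeSet)) := by
    intro i j hij
    by_contra hne
    have h1 : e i = e j := congrArg Subtype.val hij
    have h2 : e i ∈ (Us i).edgeSet ∩ (Us j).edgeSet := ⟨he i, h1 ▸ he j⟩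
    rw [(hUI i j hne).1] at h2
    exact h2
  simpa using Nat.card_le_card_of_injective _ hinj

/-- If each vertex with two neighbours in a member is a hub of that member, and the hubs of
distinct members are disjoint, then edge-disjoint members meeting exactly in `S` are
completely independent. -/
theorem CompletelyIndependent.of_hubs {S : Set V} {ι : Type*} {Ts : ι → G.Subgraph}
    (H : ι → Set V)
    (hH : ∀ i v a b, a ≠ b → (Ts i).Adj v a → (Ts i).Adj v b → v ∈ H i)
    (hdisj : ∀ i j, i ≠ j → Disjoint (H i) (H j))
    (hI : G.InternallyDisjoint S Ts) : G.CompletelyIndependent S Ts := by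
  intro p q hpq
  refine ⟨(hI p q hpq).1, (hI p q hpq).2, ?_⟩
  intro x₁ _ x₂ _ _ P Q hP hQ hPT hQT v hvP hvQ
  by_contra! hv
  have hub : ∀ i (R : G.Walk x₁ x₂), R.IsPath → (Ts i).walkIn R → v ∈ R.support → v ∈ H i := by
    intro i R hR hRT hvR
    obtain ⟨a, b, hab, ha, hb⟩ := hR.exists_two_edges hvR hv.1 hv.2
    exact hH i v a b hab (hRT _ ha) (hRT _ hb)
  exact Set.disjoint_left.1 (hdisj p q hpq) (hub p P hP hPT hvP) (hub q Q hQ hQT hvQ)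

/-- In `parentSubgraph`, a vertex with two neighbours is the root or a parent. -/
theorem eq_root_or_parent_of_two_adj {T : Set V} {r : V} {par : V → V} {v a b : V}
    (hab : a ≠ b) (ha : (parentSubgraph G T r par).Adj v a)
    (hb : (parentSubgraph G T r par).Adj v b) : v = r ∨ ∃ w ∈ T, v = par w := by
  obtain ⟨-, haT, -, ⟨-, h2⟩ | ⟨-, h2⟩⟩ := ha
  · obtain ⟨-, hbT, -, ⟨-, h4⟩ | ⟨-, h4⟩⟩ := hb
    · exact absurd (h2.trans h4.symm) hab
    · exact Or.inr ⟨b, hbT, h4⟩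
  · exact Or.inr ⟨a, haT, h2⟩

/-- The hub construction in complete bipartite graphs: the tree `j` has hubs `W j e`, `U j e`,
is rooted at `W j false`, and joins every left vertex `x` to `U j (f x)` and every right
vertex `y` to `W j (g y)`. -/
theorem le_cisstPacking_completeBipartiteGraph {α β : Type*} [Finite α] [Finite β]
    {S : Set (α ⊕ β)} {k : ℕ} (f : α → Bool) (g : β → Bool)
    (W : Fin k → Bool → α) (U : Fin k → Bool → β)
    (hA : ∃ x, Sum.inl x ∈ S) (hB : ∃ y y', y ≠ y' ∧ Sum.inr y ∈ S ∧ Sum.inr y' ∈ S)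
    (hW : ∀ i j, i ≠ j → ∀ e e', W i e ≠ W j e')
    (hU : ∀ i j, i ≠ j → ∀ e e', U i e ≠ U j e')
    (hWroot : ∀ i, W i true = W i false ∨ f (W i true) = true)
    (hUroot : ∀ i, g (U i true) = false)
    (hWU : ∀ i j, i ≠ j → ∀ e, Sum.inl (W i e) ∈ S → Sum.inr (U j (f (W i e))) ∈ S →
      g (U j (f (W i e))) ≠ e)
    (hWfree : ∀ i e, Sum.inl (W i e) ∉ S → W i true = W i false)
    (hUfree : ∀ i e, Sum.inr (U i e) ∉ S →
      U i true = U i false ∧ ∀ e', Sum.inl (W i e') ∉ S) :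
    k ≤ (completeBipartiteGraph α β).cisstPacking S := by
  classical
  let H : Fin k → Set (α ⊕ β) :=
    fun i => {v | (∃ e, v = Sum.inl (W i e)) ∨ ∃ e, v = Sum.inr (U i e)}
  let T : Fin k → Set (α ⊕ β) := fun i => S ∪ H i
  let root : Fin k → α ⊕ β := fun i => Sum.inl (W i false)
  let par : Fin k → α ⊕ β → α ⊕ β :=
    fun i => Sum.elim (fun x => Sum.inr (U i (f x))) (fun y => Sum.inl (W i (g y)))
  let d : Fin k → α ⊕ β → ℕ := fun i =>
    Sum.elim (fun x => if x = W i false then 0 else if f x = true then 2 else 4)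
      (fun y => if g y = true then 3 else 1)
  have hparH : ∀ i v, par i v ∈ H i := by
    rintro i (x | y)
    · exact Or.inr ⟨_, rfl⟩
    · exact Or.inl ⟨_, rfl⟩
  have hrootH : ∀ i, root i ∈ H i := fun i => Or.inl ⟨false, rfl⟩
  have hparG : ∀ i v, (completeBipartiteGraph α β).Adj v (par i v) := by
    rintro i (x | y) <;> simp [par]
  have hd : ∀ i v, v ≠ root i → d i (par i v) < d i v := by
    rintro i (x | y) hv
    · have hx : x ≠ W i false := fun h => hv (congrArg Sum.inl h)
      have := hUroot i
      cases hfx : f x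
      · simp only [d, par, Sum.elim_inl, Sum.elim_inr, hx, hfx, if_false]
        split <;> simp
      · simp [d, par, hx, hfx, this]
    · have := hWroot i
      cases hgy : g y
      · simp [d, par, hgy]
      · rcases this with h | h
        · simp [d, par, hgy, h]
        · simp only [d, par, Sum.elim_inl, Sum.elim_inr, hgy, h, if_true]
          split <;> simp
  have hHdisj : ∀ i j, i ≠ j → Disjoint (H i) (H j) := by
    intro i j hij
    rw [Set.disjoint_left]
    rintro v (⟨e, rfl⟩ | ⟨e, rfl⟩) (⟨e', h⟩ | ⟨e', h⟩)
    · exact hW i j hij e e' (Sum.inl_injective h)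
    · exact Sum.inl_ne_inr h
    · exact Sum.inr_ne_inl h
    · exact hU i j hij e e' (Sum.inr_injective h)
  have hadj : ∀ i v, v ∈ T i → v ≠ root i →
      (parentSubgraph (completeBipartiteGraph α β) (T i) (root i) (par i)).Adj v (par i v) :=
    fun i v hv hr => ⟨hv, Or.inr (hparH i v), hparG i v, Or.inl ⟨hr, rfl⟩⟩
  have hTT : ∀ i j, i ≠ j → T i ∩ T j = S := by
    intro i j hij
    ext v
    refine ⟨?_, fun hv => ⟨Or.inl hv, Or.inl hv⟩⟩
    rintro ⟨h1 | h1, h2 | h2⟩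
    · exact h1
    · exact h1
    · exact h2
    · exact absurd h2 (Set.disjoint_left.1 (hHdisj i j hij) h1)
  have hcross : ∀ i j, i ≠ j → ∀ v w, v ∈ S → w ∈ S → w = par i v → v = par j w → False := by
    rintro i j hij (x | y) (x' | y') hv hw h1 h2
    · exact Sum.inl_ne_inr h1
    · have h1' : y' = U i (f x) := Sum.inr_injective h1
      have h2' : x = W j (g y') := Sum.inl_injective h2
      subst h1'
      generalize he : g (U i (f x)) = e at h2'
      subst h2'
      exact hWU j i hij.symm e hv hw he
    · have h1' : x' = W i (g y) := Sum.inl_injective h1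
      have h2' : y = U j (f x') := Sum.inr_injective h2
      subst h2'
      generalize he : g (U j (f x')) = e at h1'
      subst h1'
      exact hWU i j hij e hw hv he
    · exact Sum.inr_ne_inl h1
  have hSnt : S.Nontrivial := by
    obtain ⟨y, y', hne, hy, hy'⟩ := hB
    exact ⟨_, hy, _, hy', fun h => hne (Sum.inr_injective h)⟩
  refine le_cisstPacking hSnt
    (fun i => parentSubgraph (completeBipartiteGraph α β) (T i) (root i) (par i)) ?_ ?_
  · intro i
    refine ⟨parentSubgraph_isTree (d i) (Or.inr (hrootH i))
      (fun v _ hr => ⟨Or.inr (hparH i v), hparG i v, hd i v hr⟩), fun v hv => Or.inl hv, ?_⟩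
    intro v hv hleaf
    by_contra hvS
    apply hleaf
    rcases hv.resolve_left hvS with ⟨e, rfl⟩ | ⟨e, rfl⟩
    · have hconst : ∀ e', W i e' = W i e := by
        have := hWfree i e hvS
        intro e'
        cases e <;> cases e' <;> simp [this]
      obtain ⟨y, y', hne, hy, hy'⟩ := hB
      have hyadj : ∀ z, Sum.inr z ∈ S → (parentSubgraph (completeBipartiteGraph α β) (T i)
          (root i) (par i)).Adj (Sum.inl (W i e)) (Sum.inr z) := by
        intro z hz
        have := hadj i (Sum.inr z) (Or.inl hz) Sum.inr_ne_inl
        rw [show par i (Sum.inr z) = Sum.inl (W i e) from congrArg Sum.inl (hconst _)] at this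
        exact this.symm
      exact ⟨_, _, fun h => hne (Sum.inr_injective h), hyadj y hy, hyadj y' hy'⟩
    · obtain ⟨hc, hWS⟩ := hUfree i e hvS
      have hconst : ∀ e', U i e' = U i e := by
        intro e'
        cases e <;> cases e' <;> simp [hc]
      obtain ⟨x, hx⟩ := hA
      refine ⟨Sum.inl x, par i (Sum.inr (U i e)), ?_, ?_, hadj i _ hv Sum.inr_ne_inl⟩
      · intro h
        exact hWS (g (U i e)) ((Sum.inl_injective h : x = _) ▸ hx)
      · have := hadj i (Sum.inl x) (Or.inl hx)
          (fun h => hWS false ((Sum.inl_injective h : x = _) ▸ hx))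
        rw [show par i (Sum.inl x) = Sum.inr (U i e) from congrArg Sum.inr (hconst _)] at this
        exact this.symm
  · refine CompletelyIndependent.of_hubs H ?_ hHdisj ?_
    · intro i v a b hab ha hb
      rcases eq_root_or_parent_of_two_adj hab ha hb with rfl | ⟨w, -, rfl⟩
      · exact hrootH i
      · exact hparH i w
    · intro i j hij
      refine ⟨?_, hTT i j hij⟩
      rw [Set.eq_empty_iff_forall_notMem]
      intro e
      induction e with
      | h v w =>
        rintro ⟨⟨hv, hw, -, h⟩, ⟨hv', hw', -, h'⟩⟩
        have hvS : v ∈ S := hTT i j hij ▸ ⟨hv, hv'⟩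
        have hwS : w ∈ S := hTT i j hij ▸ ⟨hw, hw'⟩
        rcases h with ⟨-, h⟩ | ⟨-, h⟩ <;> rcases h' with ⟨-, h'⟩ | ⟨-, h'⟩
        · exact Set.disjoint_left.1 (hHdisj i j hij) (h ▸ hparH i v) (h' ▸ hparH j v)
        · exact hcross i j hij v w hvS hwS h h'
        · exact hcross i j hij w v hwS hvS h h'
        · exact Set.disjoint_left.1 (hHdisj i j hij) (h ▸ hparH i w) (h' ▸ hparH j w)

end SimpleGraph

theorem stmt_10 (m₁ m₂ s i : ℕ) (h1 : 2 ≤ m₁) (h12 : m₁ ≤ m₂)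
    (hi1 : max 1 (s - m₂) ≤ i) (hi2 : i ≤ min m₁ (s - 1))
    (hs : m₂ - m₁ + 3 ≤ s)
    (h2i : 2 ≤ 2 * i) (h2i' : 2 * i ≤ m₁ + s - m₂)
    (Si : Set (Fin m₁ ⊕ Fin m₂))
    (hSi : Si = {v | (∃ t : Fin m₁, v = Sum.inl t ∧ (t : ℕ) < i) ∨
                     (∃ t : Fin m₂, v = Sum.inr t ∧ (t : ℕ) < s - i)}) :
    (3 * (2 * i) ≤ 2 * (m₁ + s - m₂) →
      m₁ - i ≤ (completeBipartiteGraph (Fin m₁) (Fin m₂)).cisstPacking Si) ∧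
    (2 * (m₁ + s - m₂) < 3 * (2 * i) →
      m₂ - (s - i) + (m₁ + s - m₂ - i) / 2 ≤
        (completeBipartiteGraph (Fin m₁) (Fin m₂)).cisstPacking Si) := by
  subst hSi
  have hl : ∀ x : Fin m₁, (Sum.inl x : Fin m₁ ⊕ Fin m₂) ∈
      {v : Fin m₁ ⊕ Fin m₂ | (∃ t : Fin m₁, v = Sum.inl t ∧ (t : ℕ) < i) ∨
        (∃ t : Fin m₂, v = Sum.inr t ∧ (t : ℕ) < s - i)} ↔ (x : ℕ) < i := by
    simp
  have hr : ∀ y : Fin m₂, (Sum.inr y : Fin m₁ ⊕ Fin m₂) ∈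
      {v : Fin m₁ ⊕ Fin m₂ | (∃ t : Fin m₁, v = Sum.inl t ∧ (t : ℕ) < i) ∨
        (∃ t : Fin m₂, v = Sum.inr t ∧ (t : ℕ) < s - i)} ↔ (y : ℕ) < s - i := by
    simp
  have hA : ∃ x : Fin m₁, (x : ℕ) < i := ⟨⟨0, by omega⟩, by simp only; omega⟩
  have hB : ∃ y y' : Fin m₂, y ≠ y' ∧ (y : ℕ) < s - i ∧ (y' : ℕ) < s - i :=
    ⟨⟨0, by omega⟩, ⟨1, by omega⟩, by simp, by simp only; omega, by simp only; omega⟩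
  constructor
  · intro h
    refine le_cisstPacking_completeBipartiteGraph (fun _ => false) (fun _ => false)
      (fun j _ => ⟨i + j, by omega⟩)
      (fun j _ => ⟨if (j : ℕ) < m₂ - (s - i) then s - i + j else j - (m₂ - (s - i)), by
        split <;> omega⟩) ?_ ?_ ?_ ?_ ?_ ?_ ?_ ?_ ?_ <;> simp only [hl, hr, ne_eq, Fin.ext_iff]
    · exact hA
    · simpa only [ne_eq, Fin.ext_iff] using hB
    · intros; omega
    · intros; split <;> split <;> omega
    · simp
    · simp
    · intros; omega
    · simp
    · intros; exact ⟨trivial, by intros; omega⟩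
  · intro h
    refine le_cisstPacking_completeBipartiteGraph (fun x => decide ((x : ℕ) % 2 = 1))
      (fun y => decide ((y : ℕ) < s - i ∧ (y : ℕ) % 2 = 0))
      (fun j e => ⟨if (j : ℕ) < m₁ - i then i + j else 2 * (j - (m₁ - i)) + e.toNat, by
        cases e <;> simp only [Bool.toNat_false, Bool.toNat_true] <;> split <;> omega⟩)
      (fun j e => ⟨if (j : ℕ) < m₂ - (s - i) then s - i + j
          else 2 * (j - (m₂ - (s - i))) + e.toNat, by
        cases e <;> simp only [Bool.toNat_false, Bool.toNat_true] <;> split <;> omega⟩)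
      ?_ ?_ ?_ ?_ ?_ ?_ ?_ ?_ ?_ <;>
      simp only [hl, hr, ne_eq, Fin.ext_iff, Bool.forall_bool, Bool.toNat_false, Bool.toNat_true,
        decide_eq_true_eq, decide_eq_false_iff_not]
    · exact hA
    · simpa only [ne_eq, Fin.ext_iff] using hB
    · intros; split <;> split <;> omega
    · intros; split <;> split <;> omega
    · intros; split <;> omega
    · intros; split <;> omega
    · intro a b hab
      have key : ∀ e : Bool, ∀ x : ℕ,
          x = (if (a : ℕ) < m₁ - i then i + a else 2 * (a - (m₁ - i)) + e.toNat) → x < i →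
          ∀ y : ℕ, y = (if (b : ℕ) < m₂ - (s - i) then s - i + b
            else 2 * (b - (m₂ - (s - i))) + (decide (x % 2 = 1)).toNat) → y < s - i →
          ¬ decide (y < s - i ∧ y % 2 = 0) = e := by
        intro e x hx hxi y hy hys
        rw [if_neg (by split at hx <;> omega)] at hx
        rw [if_neg (by split at hy <;> omega)] at hy
        cases e
        · have : decide (x % 2 = 1) = false := by
            simp only [Bool.toNat_false] at hx
            simp only [decide_eq_false_iff_not]; omega
          simp only [this, Bool.toNat_false] at hy
          simp only [decide_eq_false_iff_not]; omega
        · have : decide (x % 2 = 1) = true := by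
            simp only [Bool.toNat_true] at hx
            simp only [decide_eq_true_eq]; omega
          simp only [this, Bool.toNat_true] at hy
          simp only [decide_eq_true_eq]; omega
      exact ⟨fun h1 h2 => by simpa using key false _ rfl h1 _ rfl h2,
        fun h1 h2 => by simpa using key true _ rfl h1 _ rfl h2⟩
    · intros; constructor <;> split <;> intros <;> omega
    · intros; split_ifs <;> omega
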